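/- arXiv:2601.20111 — 6 statements merged into one kernel-verified Lean document; each statement's English description precedes it below -/
import Mathlib

section
/- Let 𝐬 = ([i_1,j_1],…,[i_r,j_r]) ∈ 𝐒ˢ be prime with signs ε_1,…,ε_r and r ≥ 2. Then: i_s < i_{r−ε_r} for all 1 ≤ s ≤ r with s ≠ r−ε_r; i_{2−ε_1} < i_p for all 1 ≤ p ≤ r with p ≠ 2−ε_1; j_s < j_{1+ε_1} for all 1 ≤ s ≤ r with s ≠ 1+ε_1; and j_{r−1+ε_r} < j_p for all 1 ≤ p ≤ r with p ≠ r−1+ε_r. -/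
/-- The interval `[a,b]` belongs to `𝕀ₙ` (integer intervals with `0 ≤ b - a ≤ n+1`). -/
def InIntv (n : ℕ) (a b : ℤ) : Prop := 0 ≤ b - a ∧ b - a ≤ (n : ℤ) + 1

/-- `([i 1, j 1], …, [i r, j r])` together with signs `ε 1, …, ε r ∈ {0,1}` is a
stable alternating snake of sink–source type (`𝐬 ∈ 𝐒ˢ`). -/
def IsSnake (n r : ℕ) (i j : ℕ → ℤ) (ε : ℕ → ℕ) : Prop :=
  (∀ s, 1 ≤ s → s ≤ r → InIntv n (i s) (j s)) ∧
  (∀ s, 1 ≤ s → s ≤ r → ε s ≤ 1) ∧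
  (∀ s p, 1 ≤ s → s < p → p ≤ r → ¬(i s = i p ∧ j s = j p)) ∧
  (∀ p, 1 ≤ p → p + 1 ≤ r →
    ε p + ε (p + 1) = 1 ∧ i (p + 1 - ε p) < i (p + ε p) ∧ j (p + 1 - ε p) < j (p + ε p)) ∧
  (∀ p s, 1 ≤ p → p + 2 ≤ s → s ≤ r → i p ≤ i s ∧ i s < j s ∧ j s ≤ j p)

/-- The snake `𝐬` is connected. -/
def IsConnectedSnake (n r : ℕ) (i j : ℕ → ℤ) (ε : ℕ → ℕ) : Prop :=
  IsSnake n r i j ε ∧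
  ∀ p, 1 ≤ p → p + 1 ≤ r →
    i (p + 1 - ε p) < i (p + ε p) ∧ i (p + ε p) ≤ j (p + 1 - ε p) ∧
      j (p + 1 - ε p) < j (p + ε p) ∧ j (p + ε p) - i (p + 1 - ε p) ≤ (n : ℤ) + 1

/-- The snake `𝐬` is prime. -/
def IsPrimeSnake (n r : ℕ) (i j : ℕ → ℤ) (ε : ℕ → ℕ) : Prop :=
  IsConnectedSnake n r i j ε ∧
  ∀ s, 1 ≤ s → s + 2 ≤ r → i s ≠ i (s + 2) ∧ j s ≠ j (s + 2)

/-- The endpoints increase strictly from `p` to `p + 1` when `ε p = 1`. -/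
theorem IsSnake.lt_succ {n r : ℕ} {i j : ℕ → ℤ} {ε : ℕ → ℕ} (h : IsSnake n r i j ε) {p : ℕ}
    (hp : 1 ≤ p) (hpr : p + 1 ≤ r) (hε : ε p = 1) : i p < i (p + 1) ∧ j p < j (p + 1) := by
  simpa [hε] using (h.2.2.2.1 p hp hpr).2

/-- The endpoints decrease strictly from `p` to `p + 1` when `ε p = 0`. -/
theorem IsSnake.succ_lt {n r : ℕ} {i j : ℕ → ℤ} {ε : ℕ → ℕ} (h : IsSnake n r i j ε) {p : ℕ}
    (hp : 1 ≤ p) (hpr : p + 1 ≤ r) (hε : ε p = 0) : i (p + 1) < i p ∧ j (p + 1) < j p := by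
  simpa [hε] using (h.2.2.2.1 p hp hpr).2

/-- In a prime snake the entry two steps later is strictly nested at both endpoints. -/
theorem IsPrimeSnake.lt_add_two {n r : ℕ} {i j : ℕ → ℤ} {ε : ℕ → ℕ} (h : IsPrimeSnake n r i j ε)
    {p : ℕ} (hp : 1 ≤ p) (hpr : p + 2 ≤ r) : i p < i (p + 2) ∧ j (p + 2) < j p := by
  have nested := h.1.1.2.2.2.2 p (p + 2) hp le_rfl hpr
  have distinct := h.2 p hp hpr
  omega

/-- If `ε p = 1`, then `i p` is smaller than every later left endpoint. -/
theorem IsPrimeSnake.left_lt_of_lt {n r : ℕ} {i j : ℕ → ℤ} {ε : ℕ → ℕ}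
    (h : IsPrimeSnake n r i j ε) {p s : ℕ} (hp : 1 ≤ p) (hε : ε p = 1) (hps : p < s)
    (hs : s ≤ r) : i p < i s := by
  have up := (h.1.1.lt_succ hp (by omega) hε).1
  obtain rfl | rfl | hlt : s = p + 1 ∨ s = p + 2 ∨ p + 3 ≤ s := by omega
  · exact up
  · exact (h.lt_add_two hp hs).1
  · exact up.trans_le (h.1.1.2.2.2.2 (p + 1) s (by omega) (by omega) hs).1

/-- If `ε p = 0`, then `j p` is larger than every later right endpoint. -/
theorem IsPrimeSnake.right_lt_of_lt {n r : ℕ} {i j : ℕ → ℤ} {ε : ℕ → ℕ}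
    (h : IsPrimeSnake n r i j ε) {p s : ℕ} (hp : 1 ≤ p) (hε : ε p = 0) (hps : p < s)
    (hs : s ≤ r) : j s < j p := by
  have down := (h.1.1.succ_lt hp (by omega) hε).2
  obtain rfl | rfl | hlt : s = p + 1 ∨ s = p + 2 ∨ p + 3 ≤ s := by omega
  · exact down
  · exact (h.lt_add_two hp hs).2
  · exact (h.1.1.2.2.2.2 (p + 1) s (by omega) (by omega) hs).2.2.trans_lt down

/-- If `ε p = 1`, then `i (p + 1)` is larger than every earlier left endpoint. -/
theorem IsPrimeSnake.left_lt_succ {n r : ℕ} {i j : ℕ → ℤ} {ε : ℕ → ℕ}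
    (h : IsPrimeSnake n r i j ε) {p s : ℕ} (hs : 1 ≤ s) (hsp : s ≤ p) (hpr : p + 1 ≤ r)
    (hε : ε p = 1) : i s < i (p + 1) := by
  have up := (h.1.1.lt_succ (by omega) hpr hε).1
  obtain rfl | rfl | hlt : p = s ∨ p = s + 1 ∨ s + 2 ≤ p := by omega
  · exact up
  · exact (h.lt_add_two hs hpr).1
  · exact (h.1.1.2.2.2.2 s p hs hlt (by omega)).1.trans_lt up

/-- If `ε p = 0`, then `j (p + 1)` is smaller than every earlier right endpoint. -/
theorem IsPrimeSnake.right_succ_lt {n r : ℕ} {i j : ℕ → ℤ} {ε : ℕ → ℕ}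
    (h : IsPrimeSnake n r i j ε) {p s : ℕ} (hs : 1 ≤ s) (hsp : s ≤ p) (hpr : p + 1 ≤ r)
    (hε : ε p = 0) : j (p + 1) < j s := by
  have down := (h.1.1.succ_lt (by omega) hpr hε).2
  obtain rfl | rfl | hlt : p = s ∨ p = s + 1 ∨ s + 2 ≤ p := by omega
  · exact down
  · exact (h.lt_add_two hs hpr).2
  · exact down.trans_le (h.1.1.2.2.2.2 s p hs hlt (by omega)).2.2

/-- Extremal entries of a prime stable alternating snake of sink–source type. -/
theorem stmt1 (n r : ℕ) (hn : 1 ≤ n) (hr : 2 ≤ r) (i j : ℕ → ℤ) (ε : ℕ → ℕ)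
    (hp : IsPrimeSnake n r i j ε) :
    (∀ s, 1 ≤ s → s ≤ r → s ≠ r - ε r → i s < i (r - ε r)) ∧
    (∀ p, 1 ≤ p → p ≤ r → p ≠ 2 - ε 1 → i (2 - ε 1) < i p) ∧
    (∀ s, 1 ≤ s → s ≤ r → s ≠ 1 + ε 1 → j s < j (1 + ε 1)) ∧
    (∀ p, 1 ≤ p → p ≤ r → p ≠ r - 1 + ε r → j (r - 1 + ε r) < j p) := by
  obtain ⟨m, rfl⟩ : ∃ m, r = m + 2 := ⟨r - 2, by omega⟩
  have alt := hp.1.1.2.2.2.1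
  have alt_first := (alt 1 le_rfl (by omega)).1
  have alt_last := (alt (m + 1) (by omega) le_rfl).1
  simp only [Nat.reduceAdd, add_assoc] at alt_first alt_last
  refine ⟨fun s hs hsr hne => ?_, fun s hs hsr hne => ?_, fun s hs hsr hne => ?_,
    fun s hs hsr hne => ?_⟩
  · obtain h | h : ε (m + 2) = 0 ∨ ε (m + 2) = 1 := by omega
    · simp only [h, Nat.sub_zero] at hne ⊢
      exact hp.left_lt_succ (p := m + 1) hs (by omega) le_rfl (by omega)
    · simp only [h, Nat.add_one_sub_one] at hne ⊢
      obtain rfl | hlt : s = m + 2 ∨ s ≤ m := by omega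
      · exact (hp.1.1.succ_lt (p := m + 1) (by omega) le_rfl (by omega)).1
      · have := (alt m (by omega) (by omega)).1
        exact hp.left_lt_succ hs hlt (by omega) (by omega)
  · obtain h | h : ε 1 = 0 ∨ ε 1 = 1 := by omega
    · simp only [h, Nat.sub_zero] at hne ⊢
      obtain rfl | hlt : s = 1 ∨ 2 < s := by omega
      · exact (hp.1.1.succ_lt le_rfl (by omega) h).1
      · exact hp.left_lt_of_lt (by omega) (by omega) hlt hsr
    · simp only [h, Nat.reduceSub] at hne ⊢
      exact hp.left_lt_of_lt le_rfl h (by omega) hsr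
  · obtain h | h : ε 1 = 0 ∨ ε 1 = 1 := by omega
    · simp only [h, Nat.add_zero] at hne ⊢
      exact hp.right_lt_of_lt le_rfl h (by omega) hsr
    · simp only [h, Nat.reduceAdd] at hne ⊢
      obtain rfl | hlt : s = 1 ∨ 2 < s := by omega
      · exact (hp.1.1.lt_succ le_rfl (by omega) h).2
      · exact hp.right_lt_of_lt (by omega) (by omega) hlt hsr
  · obtain h | h : ε (m + 2) = 0 ∨ ε (m + 2) = 1 := by omega
    · simp only [h, Nat.add_one_sub_one, Nat.add_zero] at hne ⊢
      obtain rfl | hlt : s = m + 2 ∨ s ≤ m := by omega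
      · exact (hp.1.1.lt_succ (p := m + 1) (by omega) le_rfl (by omega)).2
      · have := (alt m (by omega) (by omega)).1
        exact hp.right_succ_lt hs hlt (by omega) (by omega)
    · simp only [h, Nat.add_one_sub_one] at hne ⊢
      exact hp.right_succ_lt (p := m + 1) hs (by omega) le_rfl (by omega)
end

section
/- Let 𝐬 = ([i_1,j_1],…,[i_r,j_r]) ∈ 𝐒ˢ be prime with signs ε_1,…,ε_r, and let 1 ≤ m < p ≤ r. If i_m = i_p then p = m+3 and ε_m = 0. If j_m = j_p then p = m+3 and ε_m = 1. -/
/-- In a prime snake, a repeated left (resp. right) endpoint can only occur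
three steps apart, with the corresponding sign equal to `0` (resp. `1`). -/
theorem stmt2 (n r : ℕ) (hn : 1 ≤ n) (i j : ℕ → ℤ) (ε : ℕ → ℕ)
    (hp : IsPrimeSnake n r i j ε) (m p : ℕ) (hm : 1 ≤ m) (hmp : m < p) (hpr : p ≤ r) :
    (i m = i p → p = m + 3 ∧ ε m = 0) ∧ (j m = j p → p = m + 3 ∧ ε m = 1) := by
  obtain ⟨⟨⟨-, hε, -, halt, hnest⟩, -⟩, hprime⟩ := hp
  have hεm := hε m hm (by omega)
  obtain ⟨-, hi, hj⟩ := halt m hm (by omega)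
  rcases (by omega : p = m + 1 ∨ p = m + 2 ∨ p = m + 3 ∨ m + 4 ≤ p) with rfl | rfl | rfl | hfar
  · rcases (by omega : ε m = 0 ∨ ε m = 1) with h | h <;>
      simp only [h, Nat.add_sub_cancel, Nat.add_zero, Nat.sub_zero] at hi hj <;> omega
  · have := hprime m hm hpr
    tauto
  · have := hnest (m + 1) (m + 3) (by omega) (by omega) hpr
    rcases (by omega : ε m = 0 ∨ ε m = 1) with h | h <;>
      simp only [h, Nat.add_sub_cancel, Nat.add_zero, Nat.sub_zero] at hi hj <;> omega
  · have hne := hprime m hm (by omega)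
    have := hnest m (m + 2) hm (by omega) (by omega)
    have := hnest (m + 2) p (by omega) (by omega) hpr
    omega
end

section
/- Let 𝐬 = ([i_1,j_1],…,[i_r,j_r]) ∈ 𝐒ˢ be prime with r ≥ 3. Suppose [i_p, j_ℓ] and [i_m, j_k] are two elements of 𝕀_n(𝐬) forming a connected pair with i_m < i_p ≤ j_k < j_ℓ. Then [i_p, j_k] ∈ Ĩ_n(𝐬) and [i_m, j_ℓ] ∈ Ĩ_n(𝐬). -/
/-- Membership of the interval `[a,b]` in `Ĩₙ(𝐬)`. -/
def ItildeMem (n r : ℕ) (i j : ℕ → ℤ) (ε : ℕ → ℕ) (a b : ℤ) : Prop :=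
  InIntv n a b ∧
  ∃ p ℓ, 1 ≤ p ∧ p ≤ r ∧ 1 ≤ ℓ ∧ ℓ ≤ r ∧
    (ℓ + 1 + ε p = p ∨ ℓ + ε p = p ∨ ℓ + ε p = p + 1 ∨ ℓ + ε p = p + 2) ∧
    a = i p ∧ b = j ℓ

/-- Membership of the interval `[a,b]` in `𝕀ₙ(𝐬)`. -/
def IMem (n r : ℕ) (i j : ℕ → ℤ) (ε : ℕ → ℕ) (a b : ℤ) : Prop :=
  ItildeMem n r i j ε a b ∧ b ≠ a ∧ b ≠ a + (n : ℤ) + 1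

/-- The intervals `[a,b]` and `[c,d]` form a connected pair. -/
def ConnPair (n : ℕ) (a b c d : ℤ) : Prop :=
  min a c < max a c ∧ max a c ≤ min b d ∧ min b d < max b d ∧
    max b d - min a c ≤ (n : ℤ) + 1

/-- The signs of a snake alternate, so the parity of `p + ε p` is constant. -/
theorem IsSnake.parity {n r : ℕ} {i j : ℕ → ℤ} {ε : ℕ → ℕ} (h : IsSnake n r i j ε)
    {p : ℕ} (hp : 1 ≤ p) (hpr : p ≤ r) : (p + ε p) % 2 = (1 + ε 1) % 2 := by
  induction p, hp using Nat.le_induction with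
  | base => rfl
  | succ p hp ih =>
    have h₁ := ih (by omega)
    have h₂ := (h.2.2.2.1 p hp hpr).1
    omega

/-- Left endpoints are weakly increasing along the blocks of indices with the same
value of `p - ε p`. -/
theorem IsSnake.left_le_of_lt {n r : ℕ} {i j : ℕ → ℤ} {ε : ℕ → ℕ} (h : IsSnake n r i j ε)
    {p m : ℕ} (hp : 1 ≤ p) (hpr : p ≤ r) (hm : 1 ≤ m) (hmr : m ≤ r)
    (hlt : p + ε m < m + ε p) : i p ≤ i m := by
  have hεp := h.2.1 p hp hpr
  have hεm := h.2.1 m hm hmr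
  have hpar := (h.parity hp hpr).trans (h.parity hm hmr).symm
  rcases (by omega : p + 2 ≤ m ∨ (m = p + 1 ∧ ε p = 1)) with hpm | ⟨rfl, hε⟩
  · exact (h.2.2.2.2 p m hp hpm hmr).1
  · have hi := (h.2.2.2.1 p hp hmr).2.1
    rw [hε, Nat.add_sub_cancel] at hi
    exact hi.le

/-- Right endpoints are weakly decreasing along the blocks of indices with the same
value of `p + ε p`. -/
theorem IsSnake.right_le_of_lt {n r : ℕ} {i j : ℕ → ℤ} {ε : ℕ → ℕ} (h : IsSnake n r i j ε)
    {p m : ℕ} (hp : 1 ≤ p) (hpr : p ≤ r) (hm : 1 ≤ m) (hmr : m ≤ r)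
    (hlt : p + ε p < m + ε m) : j m ≤ j p := by
  have hεp := h.2.1 p hp hpr
  have hεm := h.2.1 m hm hmr
  have hpar := (h.parity hp hpr).trans (h.parity hm hmr).symm
  rcases (by omega : p + 2 ≤ m ∨ (m = p + 1 ∧ ε p = 0)) with hpm | ⟨rfl, hε⟩
  · exact (h.2.2.2.2 p m hp hpm hmr).2.2
  · have hj := (h.2.2.2.1 p hp hmr).2.2
    rw [hε, Nat.sub_zero, Nat.add_zero] at hj
    exact hj.le

/-- If `[a,b]` and `[c,d]` are a connected pair of elements of `𝕀ₙ(𝐬)` with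
`c < a ≤ d < b`, then `[a,d]` and `[c,b]` lie in `Ĩₙ(𝐬)`. -/
theorem stmt5 (n r : ℕ) (hn : 1 ≤ n) (hr : 3 ≤ r) (i j : ℕ → ℤ) (ε : ℕ → ℕ)
    (hp : IsPrimeSnake n r i j ε) (a b c d : ℤ)
    (hab : IMem n r i j ε a b) (hcd : IMem n r i j ε c d)
    (hconn : ConnPair n a b c d)
    (h1 : c < a) (h2 : a ≤ d) (h3 : d < b) :
    ItildeMem n r i j ε a d ∧ ItildeMem n r i j ε c b := by
  obtain ⟨⟨⟨-, -⟩, p, l, hp₁, hpr, hl₁, hlr, hpl, rfl, rfl⟩, -⟩ := hab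
  obtain ⟨⟨⟨-, -⟩, m, k, hm₁, hmr, hk₁, hkr, hmk, rfl, rfl⟩, -⟩ := hcd
  have hs : IsSnake n r i j ε := hp.1.1
  have hlen : j l - i m ≤ (n : ℤ) + 1 := by
    have := hconn.2.2.2
    rwa [max_eq_left h3.le, min_eq_right h1.le] at this
  have hi : m + ε p ≤ p + ε m :=
    not_lt.mp fun hlt => h1.not_ge (hs.left_le_of_lt hp₁ hpr hm₁ hmr hlt)
  have hj : l + ε l ≤ k + ε k :=
    not_lt.mp fun hlt => h3.not_ge (hs.right_le_of_lt hk₁ hkr hl₁ hlr hlt)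
  have hεp := hs.2.1 p hp₁ hpr
  have hεl := hs.2.1 l hl₁ hlr
  have hεm := hs.2.1 m hm₁ hmr
  have hεk := hs.2.1 k hk₁ hkr
  have hpar_p := hs.parity hp₁ hpr
  have hpar_l := hs.parity hl₁ hlr
  have hpar_m := hs.parity hm₁ hmr
  have hpar_k := hs.parity hk₁ hkr
  exact ⟨⟨⟨by omega, by omega⟩, p, k, hp₁, hpr, hk₁, hkr, by omega, rfl, rfl⟩,
    ⟨⟨by omega, by omega⟩, m, l, hm₁, hmr, hl₁, hlr, by omega, rfl, rfl⟩⟩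
end

section
/- Let 𝐬 = ([i_1,j_1],…,[i_r,j_r]) ∈ 𝐒ˢ be prime with signs ε_1,…,ε_r and r ≥ 3. Then each of the following pairs consists of two distinct elements of 𝕀_n forming a connected pair (and hence, ordered suitably, is a prime two-interval element of 𝐒ˢ): (1) ([i_1,j_1], [i_{2+ε_1}, j_{3−ε_1}]); (2) ([i_s,j_s], [i_{s+1−2ε_s}, j_{s−1+2ε_s}]) for every 1 < s < r; (3) ([i_r,j_r], [i_{r−2+ε_r}, j_{r−1−ε_r}]); (4) ([i_{s−ε_s}, j_{s−1+ε_s}], [i_{s+1+ε_s}, j_{s+2−ε_s}]) for every 2 ≤ s ≤ r−2 with i_{s−1} ≠ i_{s+2} and j_{s−1} ≠ j_{s+2}. -/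
/-- `[a,b]` and `[c,d]` are two distinct elements of `𝕀ₙ` forming a connected pair. -/
def GoodPair (n : ℕ) (a b c d : ℤ) : Prop :=
  InIntv n a b ∧ InIntv n c d ∧ (a, b) ≠ (c, d) ∧ ConnPair n a b c d

/-- Ordered suitably, `([a,b],[c,d])` is a prime two-interval element of `𝐒ˢ`. -/
def PrimePair (n : ℕ) (a b c d : ℤ) : Prop :=
  ∃ i' j' : ℕ → ℤ, ∃ ε' : ℕ → ℕ, IsPrimeSnake n 2 i' j' ε' ∧
    (((i' 1, j' 1) = (a, b) ∧ (i' 2, j' 2) = (c, d)) ∨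
     ((i' 1, j' 1) = (c, d) ∧ (i' 2, j' 2) = (a, b)))

/-- Two overlapping intervals, the first to the left of the second, form a prime pair. -/
theorem goodPair_and_primePair {n : ℕ} {a b c d : ℤ} (hac : a < c) (hcb : c ≤ b) (hbd : b < d)
    (hda : d - a ≤ (n : ℤ) + 1) : GoodPair n a b c d ∧ PrimePair n a b c d := by
  constructor
  · refine ⟨⟨by omega, by omega⟩, ⟨by omega, by omega⟩, ?_, ?_⟩
    · simp only [ne_eq, Prod.mk.injEq]
      omega
    · unfold ConnPair
      omega
  · refine ⟨fun k => if k = 1 then a else c, fun k => if k = 1 then b else d,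
      fun k => if k = 1 then 1 else 0, ⟨⟨⟨?_, ?_, ?_, ?_, ?_⟩, ?_⟩, ?_⟩, Or.inl ⟨rfl, rfl⟩⟩
    · intro s _ _
      unfold InIntv
      dsimp only
      split_ifs <;> omega
    · intro s _ _
      dsimp only
      split_ifs <;> omega
    · intro s p _ _ _
      obtain rfl : s = 1 := by omega
      obtain rfl : p = 2 := by omega
      simp only [OfNat.ofNat_ne_one, if_true, if_false]
      omega
    · intro p _ _
      obtain rfl : p = 1 := by omega
      simpa using ⟨hac, hbd⟩
    · intro p s _ _ _
      omega
    · intro p _ _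
      obtain rfl : p = 1 := by omega
      simpa using ⟨hac, hcb, hbd, by omega⟩
    · intro s _ _
      omega

/-- Two overlapping intervals, the first to the right of the second, form a prime pair. -/
theorem goodPair_and_primePair_symm {n : ℕ} {a b c d : ℤ} (hac : a < c) (hcb : c ≤ b)
    (hbd : b < d) (hda : d - a ≤ (n : ℤ) + 1) : GoodPair n c d a b ∧ PrimePair n c d a b := by
  obtain ⟨⟨h₁, h₂, h₃, h₄⟩, i', j', ε', hs, he⟩ := goodPair_and_primePair hac hcb hbd hda
  refine ⟨⟨h₂, h₁, h₃.symm, ?_⟩, i', j', ε', hs, he.symm⟩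
  unfold ConnPair at h₄ ⊢
  omega

namespace IsPrimeSnake

variable {n r : ℕ} {i j : ℕ → ℤ} {ε : ℕ → ℕ}

theorem sign_cases (h : IsPrimeSnake n r i j ε) {p : ℕ} (hp : 1 ≤ p) (hpr : p + 1 ≤ r) :
    (ε p = 0 ∧ ε (p + 1) = 1 ∧ i (p + 1) < i p ∧ i p ≤ j (p + 1) ∧ j (p + 1) < j p ∧
      j p - i (p + 1) ≤ (n : ℤ) + 1) ∨
    (ε p = 1 ∧ ε (p + 1) = 0 ∧ i p < i (p + 1) ∧ i (p + 1) ≤ j p ∧ j p < j (p + 1) ∧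
      j (p + 1) - i p ≤ (n : ℤ) + 1) := by
  have hs := (h.1.1.2.2.2.1 p hp hpr).1
  have hc := h.1.2 p hp hpr
  have h01 : ε p = 0 ∨ ε p = 1 := by omega
  rcases h01 with h0 | h1
  · rw [h0] at hs hc
    exact Or.inl ⟨h0, by omega, hc⟩
  · rw [h1] at hs hc
    exact Or.inr ⟨h1, by omega, hc⟩

theorem nested (h : IsPrimeSnake n r i j ε) {p : ℕ} (hp : 1 ≤ p) (hpr : p + 2 ≤ r) :
    i p < i (p + 2) ∧ i (p + 2) < j (p + 2) ∧ j (p + 2) < j p := by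
  have hc := h.1.1.2.2.2.2 p (p + 2) hp le_rfl hpr
  have hne := h.2 p hp hpr
  omega

end IsPrimeSnake

/-- The pairs of intervals listed in the definition of `𝐟𝐨𝐫(𝐬)` are distinct
connected pairs in `𝕀ₙ`, hence prime two-interval elements of `𝐒ˢ`. -/
theorem stmt11 (n r : ℕ) (hn : 1 ≤ n) (hr : 3 ≤ r) (i j : ℕ → ℤ) (ε : ℕ → ℕ)
    (hp : IsPrimeSnake n r i j ε) :
    (GoodPair n (i 1) (j 1) (i (2 + ε 1)) (j (3 - ε 1)) ∧
      PrimePair n (i 1) (j 1) (i (2 + ε 1)) (j (3 - ε 1))) ∧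
    (∀ s, 1 < s → s < r →
      GoodPair n (i s) (j s) (i (s + 1 - 2 * ε s)) (j (s - 1 + 2 * ε s)) ∧
      PrimePair n (i s) (j s) (i (s + 1 - 2 * ε s)) (j (s - 1 + 2 * ε s))) ∧
    (GoodPair n (i r) (j r) (i (r - 2 + ε r)) (j (r - 1 - ε r)) ∧
      PrimePair n (i r) (j r) (i (r - 2 + ε r)) (j (r - 1 - ε r))) ∧
    (∀ s, 2 ≤ s → s + 2 ≤ r → i (s - 1) ≠ i (s + 2) → j (s - 1) ≠ j (s + 2) →
      GoodPair n (i (s - ε s)) (j (s - 1 + ε s)) (i (s + 1 + ε s)) (j (s + 2 - ε s)) ∧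
      PrimePair n (i (s - ε s)) (j (s - 1 + ε s)) (i (s + 1 + ε s)) (j (s + 2 - ε s))) := by
  have key {a b c d : ℤ} (hk : (a < c ∧ c ≤ b ∧ b < d ∧ d - a ≤ (n : ℤ) + 1) ∨
      (c < a ∧ a ≤ d ∧ d < b ∧ b - c ≤ (n : ℤ) + 1)) :
      GoodPair n a b c d ∧ PrimePair n a b c d := by
    rcases hk with ⟨h₁, h₂, h₃, h₄⟩ | ⟨h₁, h₂, h₃, h₄⟩
    · exact goodPair_and_primePair h₁ h₂ h₃ h₄
    · exact goodPair_and_primePair_symm h₁ h₂ h₃ h₄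
  refine ⟨?_, ?_, ?_, ?_⟩
  · have c₁ := hp.sign_cases (p := 1) le_rfl (by omega)
    have c₂ := hp.sign_cases (p := 2) (by omega) (by omega)
    have m := hp.nested (p := 1) le_rfl (by omega)
    norm_num at c₁ c₂ m
    apply key
    rcases c₁ with c₁ | c₁ <;> rw [c₁.1] <;> norm_num <;> omega
  · intro s hs hsr
    obtain ⟨p, rfl⟩ : ∃ p, s = p + 1 := ⟨s - 1, by omega⟩
    have c₁ := hp.sign_cases (p := p) (by omega) (by omega)
    have c₂ := hp.sign_cases (p := p + 1) (by omega) (by omega)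
    have m := hp.nested (p := p) (by omega) (by omega)
    rw [show p + 1 + 1 = p + 2 from rfl] at c₂
    apply key
    rcases c₁ with c₁ | c₁ <;> rw [c₁.2.1]
    · rw [show p + 1 + 1 - 2 * 1 = p by omega, show p + 1 - 1 + 2 * 1 = p + 2 by omega]
      omega
    · rw [show p + 1 + 1 - 2 * 0 = p + 2 by omega, show p + 1 - 1 + 2 * 0 = p by omega]
      omega
  · obtain ⟨p, rfl⟩ : ∃ p, r = p + 2 := ⟨r - 2, by omega⟩
    have c₁ := hp.sign_cases (p := p) (by omega) (by omega)
    have c₂ := hp.sign_cases (p := p + 1) (by omega) (by omega)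
    have m := hp.nested (p := p) (by omega) (by omega)
    rw [show p + 1 + 1 = p + 2 from rfl] at c₂
    apply key
    rcases c₂ with c₂ | c₂ <;> rw [c₂.2.1]
    · rw [show p + 2 - 2 + 1 = p + 1 by omega, show p + 2 - 1 - 1 = p by omega]
      omega
    · rw [show p + 2 - 2 + 0 = p by omega, show p + 2 - 1 - 0 = p + 1 by omega]
      omega
  · intro s hs hsr hi hj
    obtain ⟨p, rfl⟩ : ∃ p, s = p + 1 := ⟨s - 1, by omega⟩
    have c₁ := hp.sign_cases (p := p) (by omega) (by omega)
    have c₂ := hp.sign_cases (p := p + 1) (by omega) (by omega)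
    have c₃ := hp.sign_cases (p := p + 2) (by omega) (by omega)
    have m₁ := hp.nested (p := p) (by omega) (by omega)
    have m₂ := hp.nested (p := p + 1) (by omega) (by omega)
    have m₃ := hp.1.1.2.2.2.2 p (p + 3) (by omega) (by omega) (by omega)
    rw [show p + 1 + 1 = p + 2 from rfl] at c₂
    rw [show p + 2 + 1 = p + 3 from rfl] at c₃
    rw [show p + 1 + 2 = p + 3 from rfl] at m₂ hi hj
    rw [show p + 1 - 1 = p from rfl] at hi hj
    apply key
    rcases c₁ with c₁ | c₁ <;> rw [c₁.2.1]
    · rw [show p + 1 - 1 = p from rfl, show p + 1 + 1 + 1 = p + 3 from rfl,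
        show p + 1 + 2 - 1 = p + 2 by omega]
      omega
    · rw [show p + 1 - 0 = p + 1 from rfl, show p + 1 - 1 + 0 = p by omega,
        show p + 1 + 1 + 0 = p + 2 from rfl, show p + 1 + 2 - 0 = p + 3 from rfl]
      omega
end

section
/- Let 𝐬 = ([i_1,j_1],…,[i_r,j_r]) ∈ 𝐒ˢ ∩ 𝕀_n^r and 𝐬' = ([i'_1,j'_1],…,[i'_r,j'_r]) ∈ 𝐒ˢ ∩ 𝕀_N^r both be prime with r ≥ 3, with signs ε_1,…,ε_r and ε'_1,…,ε'_r respectively, and assume: (1) ε_m = ε'_m for 1 ≤ m ≤ r; (2) for 2 ≤ m ≤ r−2, i_{m−1} = i_{m+2} if and only if i'_{m−1} = i'_{m+2}, and j_{m−1} = j_{m+2} if and only if j'_{m−1} = j'_{m+2}; (3) for all 1 ≤ m, ℓ ≤ r, [i_m, j_ℓ] ∈ 𝕀_n(𝐬) if and only if [i'_m, j'_ℓ] ∈ 𝕀_N(𝐬'). Then: whenever [i_m, j_ℓ] ∈ 𝕀_n(𝐬) and i_m = i_p, j_ℓ = j_k for some 1 ≤ p, k ≤ r, one has i'_m = i'_p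 and j'_ℓ = j'_k; consequently there is a well-defined map φ : 𝕀_n(𝐬) → 𝕀_N(𝐬') with φ([i_m, j_ℓ]) = [i'_m, j'_ℓ] for all m, ℓ with [i_m, j_ℓ] ∈ 𝕀_n(𝐬), and φ is a bijection. -/
/-- In a prime snake, equal left endpoints occur only at distance three. -/
theorem IsPrimeSnake.eq_add_three_of_left_eq {n r : ℕ} {i j : ℕ → ℤ} {ε : ℕ → ℕ}
    (hs : IsPrimeSnake n r i j ε) {m p : ℕ} (hm : 1 ≤ m) (hmp : m < p) (hp : p ≤ r)
    (h : i m = i p) : p = m + 3 := by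
  obtain ⟨⟨⟨-, hε, -, hstep, hnest⟩, -⟩, hprime⟩ := hs
  obtain rfl | hp2 : p = m + 1 ∨ m + 2 ≤ p := by omega
  · have hlt := (hstep m hm hp).2.1
    have hεm := hε m hm (by omega)
    obtain h0 | h0 : ε m = 0 ∨ ε m = 1 := by omega
    all_goals simp only [h0, Nat.sub_zero, Nat.add_zero, Nat.add_sub_cancel] at hlt; omega
  · have hne := (hprime m hm (by omega)).1
    have hle := (hnest m (m + 2) hm le_rfl (by omega)).1
    obtain rfl | h3 | h4 : p = m + 2 ∨ p = m + 3 ∨ m + 2 + 2 ≤ p := by omega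
    · exact absurd h hne
    · exact h3
    · have := (hnest (m + 2) p (by omega) h4 hp).1
      omega

/-- In a prime snake, equal right endpoints occur only at distance three. -/
theorem IsPrimeSnake.eq_add_three_of_right_eq {n r : ℕ} {i j : ℕ → ℤ} {ε : ℕ → ℕ}
    (hs : IsPrimeSnake n r i j ε) {m p : ℕ} (hm : 1 ≤ m) (hmp : m < p) (hp : p ≤ r)
    (h : j m = j p) : p = m + 3 := by
  obtain ⟨⟨⟨-, hε, -, hstep, hnest⟩, -⟩, hprime⟩ := hs
  obtain rfl | hp2 : p = m + 1 ∨ m + 2 ≤ p := by omega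
  · have hlt := (hstep m hm hp).2.2
    have hεm := hε m hm (by omega)
    obtain h0 | h0 : ε m = 0 ∨ ε m = 1 := by omega
    all_goals simp only [h0, Nat.sub_zero, Nat.add_zero, Nat.add_sub_cancel] at hlt; omega
  · have hne := (hprime m hm (by omega)).2
    have hle := (hnest m (m + 2) hm le_rfl (by omega)).2.2
    obtain rfl | h3 | h4 : p = m + 2 ∨ p = m + 3 ∨ m + 2 + 2 ≤ p := by omega
    · exact absurd h hne
    · exact h3
    · have := (hnest (m + 2) p (by omega) h4 hp).2.2
      omega

/-- If coincidences of `f` on `[1, r]` occur only at distance three, and those are inherited by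
`g`, then every coincidence of `f` on `[1, r]` is inherited by `g`. -/
theorem eq_of_eq_of_eq_add_three {r : ℕ} {f g : ℕ → ℤ}
    (hf : ∀ m p, 1 ≤ m → m < p → p ≤ r → f m = f p → p = m + 3)
    (hfg : ∀ m, 2 ≤ m → m + 2 ≤ r → f (m - 1) = f (m + 2) → g (m - 1) = g (m + 2))
    {m p : ℕ} (hm : 1 ≤ m) (hmr : m ≤ r) (hp : 1 ≤ p) (hpr : p ≤ r) (h : f m = f p) :
    g m = g p := by
  rcases lt_trichotomy m p with hlt | rfl | hlt
  · obtain rfl := hf m p hm hlt hpr h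
    exact hfg (m + 1) (by omega) hpr h
  · rfl
  · obtain rfl := hf p m hp hlt hmr h.symm
    exact (hfg (p + 1) (by omega) hmr h.symm).symm

/-- The assignment `[i_m, j_ℓ] ↦ [i'_m, j'_ℓ]` is well defined and gives a
bijection `𝕀ₙ(𝐬) → 𝕀_N(𝐬')`. -/
theorem stmt12 (n N r : ℕ) (hn : 1 ≤ n) (hN : 1 ≤ N) (hr : 3 ≤ r)
    (i j i' j' : ℕ → ℤ) (ε ε' : ℕ → ℕ)
    (hs : IsPrimeSnake n r i j ε) (hs' : IsPrimeSnake N r i' j' ε')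
    (h1 : ∀ m, 1 ≤ m → m ≤ r → ε m = ε' m)
    (h2 : ∀ m, 2 ≤ m → m + 2 ≤ r →
      ((i (m - 1) = i (m + 2)) ↔ (i' (m - 1) = i' (m + 2))) ∧
      ((j (m - 1) = j (m + 2)) ↔ (j' (m - 1) = j' (m + 2))))
    (h3 : ∀ m ℓ, 1 ≤ m → m ≤ r → 1 ≤ ℓ → ℓ ≤ r →
      (IMem n r i j ε (i m) (j ℓ) ↔ IMem N r i' j' ε' (i' m) (j' ℓ))) :
    (∀ m ℓ p k, 1 ≤ m → m ≤ r → 1 ≤ ℓ → ℓ ≤ r → 1 ≤ p → p ≤ r → 1 ≤ k → k ≤ r →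
      IMem n r i j ε (i m) (j ℓ) → i m = i p → j ℓ = j k → i' m = i' p ∧ j' ℓ = j' k) ∧
    ∃ φ : ℤ × ℤ → ℤ × ℤ,
      (∀ m ℓ, 1 ≤ m → m ≤ r → 1 ≤ ℓ → ℓ ≤ r → IMem n r i j ε (i m) (j ℓ) →
        φ (i m, j ℓ) = (i' m, j' ℓ)) ∧
      Set.BijOn φ {x : ℤ × ℤ | IMem n r i j ε x.1 x.2}
        {x : ℤ × ℤ | IMem N r i' j' ε' x.1 x.2} := by
  have hi : ∀ m p, 1 ≤ m → m ≤ r → 1 ≤ p → p ≤ r → i m = i p → i' m = i' p :=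
    fun _ _ hm hmr hp hpr h => eq_of_eq_of_eq_add_three
      (fun _ _ => hs.eq_add_three_of_left_eq) (fun q hq hqr => (h2 q hq hqr).1.1) hm hmr hp hpr h
  have hi' : ∀ m p, 1 ≤ m → m ≤ r → 1 ≤ p → p ≤ r → i' m = i' p → i m = i p :=
    fun _ _ hm hmr hp hpr h => eq_of_eq_of_eq_add_three
      (fun _ _ => hs'.eq_add_three_of_left_eq) (fun q hq hqr => (h2 q hq hqr).1.2) hm hmr hp hpr h
  have hj : ∀ m p, 1 ≤ m → m ≤ r → 1 ≤ p → p ≤ r → j m = j p → j' m = j' p :=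
    fun _ _ hm hmr hp hpr h => eq_of_eq_of_eq_add_three
      (fun _ _ => hs.eq_add_three_of_right_eq) (fun q hq hqr => (h2 q hq hqr).2.1) hm hmr hp hpr h
  have hj' : ∀ m p, 1 ≤ m → m ≤ r → 1 ≤ p → p ≤ r → j' m = j' p → j m = j p :=
    fun _ _ hm hmr hp hpr h => eq_of_eq_of_eq_add_three
      (fun _ _ => hs'.eq_add_three_of_right_eq) (fun q hq hqr => (h2 q hq hqr).2.2) hm hmr hp hpr h
  refine ⟨fun m ℓ p k hm hmr hl hlr hp hpr hk hkr _ him hjl =>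
    ⟨hi m p hm hmr hp hpr him, hj ℓ k hl hlr hk hkr hjl⟩, ?_⟩
  have hex : ∀ x : ℤ × ℤ, ∃ y : ℤ × ℤ, ∀ m ℓ, 1 ≤ m → m ≤ r → 1 ≤ ℓ → ℓ ≤ r →
      x = (i m, j ℓ) → y = (i' m, j' ℓ) := by
    intro x
    by_cases hx : ∃ m ℓ, 1 ≤ m ∧ m ≤ r ∧ 1 ≤ ℓ ∧ ℓ ≤ r ∧ x = (i m, j ℓ)
    · obtain ⟨p, k, hp, hpr, hk, hkr, rfl⟩ := hx
      refine ⟨(i' p, j' k), fun m ℓ hm hmr hl hlr h => ?_⟩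
      rw [Prod.mk.injEq] at h ⊢
      exact ⟨hi p m hp hpr hm hmr h.1, hj k ℓ hk hkr hl hlr h.2⟩
    · exact ⟨x, fun m ℓ hm hmr hl hlr h => absurd ⟨m, ℓ, hm, hmr, hl, hlr, h⟩ hx⟩
  choose φ hφ using hex
  refine ⟨φ, fun m ℓ hm hmr hl hlr _ => hφ _ m ℓ hm hmr hl hlr rfl, ?_, ?_, ?_⟩
  · rintro ⟨a, b⟩ hab
    obtain ⟨⟨-, m, ℓ, hm, hmr, hl, hlr, -, rfl, rfl⟩, -⟩ := id hab
    rw [hφ _ m ℓ hm hmr hl hlr rfl]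
    exact (h3 m ℓ hm hmr hl hlr).1 hab
  · rintro ⟨a, b⟩ ⟨⟨-, m, ℓ, hm, hmr, hl, hlr, -, rfl, rfl⟩, -⟩
      ⟨c, d⟩ ⟨⟨-, p, k, hp, hpr, hk, hkr, -, rfl, rfl⟩, -⟩ h
    rw [hφ _ m ℓ hm hmr hl hlr rfl, hφ _ p k hp hpr hk hkr rfl, Prod.mk.injEq] at h
    exact Prod.ext (hi' m p hm hmr hp hpr h.1) (hj' ℓ k hl hlr hk hkr h.2)
  · rintro ⟨a, b⟩ hab
    obtain ⟨⟨-, m, ℓ, hm, hmr, hl, hlr, -, rfl, rfl⟩, -⟩ := id hab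
    exact ⟨(i m, j ℓ), (h3 m ℓ hm hmr hl hlr).2 hab, hφ _ m ℓ hm hmr hl hlr rfl⟩
end

section
/- Let 𝐬 = ([i_1,j_1],…,[i_r,j_r]) ∈ 𝐒ˢ be prime with r ≥ 3 and set N = N(𝐬). Then there exists a unique function ξ : {1,…,N} → ℤ satisfying: (1) |ξ(t+1) − ξ(t)| ≤ 1 for 1 ≤ t ≤ N−1; (2) ξ(p_r) = p_r; (3) ξ(p_m − 1) = ξ(p_m + 1) for every 1 ≤ m ≤ r with 2 ≤ p_m ≤ N−1; (4) ξ(p_{m+1−ε_{r−m}}) − ξ(p_{m+ε_{r−m}}) = p_{m+1} − p_m for 1 ≤ m ≤ r−1. Moreover this ξ satisfies ξ(t) ≡ t (mod 2) for all 1 ≤ t ≤ N. -/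
/-- `N(𝐬) = r + #{2 ≤ s ≤ r-2 : i (s-1) ≠ i (s+2) and j (s-1) ≠ j (s+2)}`. -/
def Nval (r : ℕ) (i j : ℕ → ℤ) : ℕ :=
  r + ((Finset.Icc 2 (r - 2)).filter
    (fun s => i (s - 1) ≠ i (s + 2) ∧ j (s - 1) ≠ j (s + 2))).card

/-- The sequence `p_1, …, p_r` attached to a prime snake:
`p 1 = 1`, `p 2 = 2`, `p r = p (r-1) + 1`, and for `2 ≤ m ≤ r-2`,
`p (m+1) = p m + 2` if `i (r-m+2) ≠ i (r-m-1)` and `j (r-m+2) ≠ j (r-m-1)`,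
and `p (m+1) = p m + 1` otherwise. -/
def pSeq (r : ℕ) (i j : ℕ → ℤ) : ℕ → ℕ
  | 0 => 0
  | 1 => 1
  | 2 => 2
  | m + 3 =>
    pSeq r i j (m + 2) +
      (if m + 3 = r then 1
       else if i (r - m) ≠ i (r - m - 3) ∧ j (r - m) ≠ j (r - m - 3) then 2 else 1)

/-- The defining conditions of the height function `ξ = ξ_𝐬 : {1,…,N} → ℤ`. -/
def HeightCond (r N : ℕ) (p ε : ℕ → ℕ) (ξ : ℕ → ℤ) : Prop :=
  (∀ t, 1 ≤ t → t + 1 ≤ N → |ξ (t + 1) - ξ t| ≤ 1) ∧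
  ξ (p r) = (p r : ℤ) ∧
  (∀ m, 1 ≤ m → m ≤ r → 2 ≤ p m → p m + 1 ≤ N → ξ (p m - 1) = ξ (p m + 1)) ∧
  (∀ m, 1 ≤ m → m + 1 ≤ r →
    ξ (p (m + 1 - ε (r - m))) - ξ (p (m + ε (r - m))) = (p (m + 1) : ℤ) - (p m : ℤ))

/-- `s_m = p_{r-m+1}`. -/
def sIdx (r : ℕ) (i j : ℕ → ℤ) (m : ℕ) : ℕ := pSeq r i j (r - m + 1)

/-- `i'_{s_m} = (ξ(s_m) - s_m)/2 - ε_m`. -/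
def iPr (r : ℕ) (i j : ℕ → ℤ) (ε : ℕ → ℕ) (ξ : ℕ → ℤ) (m : ℕ) : ℤ :=
  (ξ (sIdx r i j m) - (sIdx r i j m : ℤ)) / 2 - (ε m : ℤ)

/-- `j'_{s_m} = (ξ(s_m) + s_m)/2 - ε_m`. -/
def jPr (r : ℕ) (i j : ℕ → ℤ) (ε : ℕ → ℕ) (ξ : ℕ → ℤ) (m : ℕ) : ℤ :=
  (ξ (sIdx r i j m) + (sIdx r i j m : ℤ)) / 2 - (ε m : ℤ)

theorem pSeq_lt_succ (r : ℕ) (i j : ℕ → ℤ) (m : ℕ) : pSeq r i j m < pSeq r i j (m + 1) := by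
  match m with
  | 0 => simp [pSeq]
  | 1 => simp [pSeq]
  | m + 2 =>
    rw [pSeq]
    split_ifs <;> omega

/-- Each `m < r` accounts for the indices `s > r - m` counted by `Nval`. -/
theorem pSeq_eq_add_card (r : ℕ) (i j : ℕ → ℤ) (m : ℕ) (hm : m + 3 ≤ r) :
    pSeq r i j (m + 2) = m + 2 + ((Finset.Icc (r - m - 1) (r - 2)).filter
      (fun s => i (s - 1) ≠ i (s + 2) ∧ j (s - 1) ≠ j (s + 2))).card := by
  induction m with
  | zero => rw [Finset.Icc_eq_empty (by omega)]; simp [pSeq]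
  | succ m ih =>
    have hins : Finset.Icc (r - (m + 1) - 1) (r - 2) =
        insert (r - m - 2) (Finset.Icc (r - m - 1) (r - 2)) := by
      ext x
      simp only [Finset.mem_Icc, Finset.mem_insert]
      omega
    have hnot : r - m - 2 ∉ Finset.Icc (r - m - 1) (r - 2) := by
      simp only [Finset.mem_Icc]
      omega
    rw [show m + 1 + 2 = m + 3 by ring, pSeq, ih (by omega), hins, Finset.filter_insert,
      if_neg (show ¬ m + 3 = r by omega), show r - m - 2 - 1 = r - m - 3 by omega,
      show r - m - 2 + 2 = r - m by omega]
    by_cases h : i (r - m) ≠ i (r - m - 3) ∧ j (r - m) ≠ j (r - m - 3)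
    · rw [if_pos h, if_pos ⟨h.1.symm, h.2.symm⟩,
        Finset.card_insert_of_notMem (fun h => hnot (Finset.mem_filter.mp h).1)]
      ring
    · rw [if_neg h, if_neg (fun h' => h ⟨h'.1.symm, h'.2.symm⟩)]
      ring

theorem pSeq_self_eq_Nval (r : ℕ) (hr : 3 ≤ r) (i j : ℕ → ℤ) : pSeq r i j r = Nval r i j := by
  obtain ⟨m, rfl⟩ := Nat.exists_eq_add_of_le' hr
  rw [pSeq, if_pos rfl, pSeq_eq_add_card _ i j m le_rfl, Nval,
    show m + 3 - m - 1 = 2 by omega]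
  ring

/-- The slope of the height function between `p m` and `p (m + 1)`. -/
def heightSlope (r : ℕ) (ε : ℕ → ℕ) (m : ℕ) : ℤ := if ε (r - m) = 0 then 1 else -1

theorem heightSlope_cases (r : ℕ) (ε : ℕ → ℕ) (m : ℕ) :
    heightSlope r ε m = 1 ∨ heightSlope r ε m = -1 := by
  unfold heightSlope
  split_ifs <;> simp

theorem heightSlope_succ {r : ℕ} {ε : ℕ → ℕ}
    (hε : ∀ p, 1 ≤ p → p + 1 ≤ r → ε p + ε (p + 1) = 1) {m : ℕ} (hm : 1 ≤ m) (hmr : m + 1 < r) :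
    heightSlope r ε (m + 1) = -heightSlope r ε m := by
  have h := hε (r - (m + 1)) (by omega) (by omega)
  rw [show r - (m + 1) + 1 = r - m by omega] at h
  unfold heightSlope
  split_ifs <;> omega

/-- The fourth height condition prescribes the slope on each segment. -/
theorem slope_condition_iff {r : ℕ} {p ε : ℕ → ℕ} {ξ : ℕ → ℤ} {m : ℕ} (hε : ε (r - m) ≤ 1) :
    ξ (p (m + 1 - ε (r - m))) - ξ (p (m + ε (r - m))) = (p (m + 1) : ℤ) - (p m : ℤ) ↔
      ξ (p (m + 1)) - ξ (p m) = heightSlope r ε m * ((p (m + 1) : ℤ) - p m) := by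
  unfold heightSlope
  obtain h | h : ε (r - m) = 0 ∨ ε (r - m) = 1 := by omega
  · simp [h]
  · simp only [h, Nat.add_sub_cancel, one_ne_zero, if_false]
    constructor <;> intro h' <;> linarith

/-- A sequence with steps at most one attaining the maximal increase is affine. -/
theorem eq_sub_of_step_le_one {f : ℕ → ℤ} {a b : ℕ}
    (hf : ∀ t, a ≤ t → t < b → f (t + 1) - f t ≤ 1) (hab : f b - f a = (b : ℤ) - a)
    {t : ℕ} (hat : a ≤ t) (htb : t ≤ b) : f t = f b - ((b : ℤ) - t) := by
  have key : ∀ k c : ℕ, a ≤ c → c + k ≤ b → f (c + k) - f c ≤ k := by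
    intro k
    induction k with
    | zero => simp
    | succ k ih =>
      intro c hc hk
      have h₁ := ih c hc (by omega)
      have h₂ := hf (c + k) (by omega) (by omega)
      rw [← add_assoc]
      push_cast
      linarith
  have h₁ := key (t - a) a le_rfl (by omega)
  have h₂ := key (b - t) t hat (by omega)
  rw [Nat.add_sub_cancel' hat, Nat.cast_sub hat] at h₁
  rw [Nat.add_sub_cancel' htb, Nat.cast_sub htb] at h₂
  linarith

theorem sum_range_sub_of_const {e : ℕ → ℤ} {s : ℤ} {a b : ℕ} (hab : a ≤ b)
    (h : ∀ t, a ≤ t → t < b → e t = s) :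
    ∑ t ∈ Finset.range b, e t - ∑ t ∈ Finset.range a, e t = s * ((b : ℤ) - a) := by
  rw [← Finset.sum_Ico_eq_sub _ hab,
    Finset.sum_congr rfl fun t ht => h t (Finset.mem_Ico.mp ht).1 (Finset.mem_Ico.mp ht).2]
  simp [Nat.cast_sub hab, mul_comm]

section HeightCond

variable {r : ℕ} {p ε : ℕ → ℕ}

theorem HeightCond.eq_on_segment (hmono : StrictMono p) (hp1 : p 1 = 1)
    (hε : ∀ s, 1 ≤ s → s ≤ r → ε s ≤ 1) {ξ : ℕ → ℤ} (hξ : HeightCond r (p r) p ε ξ)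
    {m : ℕ} (hm : 1 ≤ m) (hmr : m + 1 ≤ r) {t : ℕ} (ht : p m ≤ t) (ht' : t ≤ p (m + 1)) :
    ξ t = ξ (p (m + 1)) - heightSlope r ε m * ((p (m + 1) : ℤ) - t) := by
  obtain ⟨hstep, -, -, hslope⟩ := hξ
  have hinc := (slope_condition_iff (hε _ (by omega) (by omega))).mp (hslope m hm hmr)
  have hpm := hmono.monotone hm
  have hpr := hmono.monotone hmr
  have habs : ∀ u, p m ≤ u → u < p (m + 1) → |ξ (u + 1) - ξ u| ≤ 1 := fun u hu hu' =>
    hstep u (by omega) (by omega)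
  rcases heightSlope_cases r ε m with hs | hs <;> rw [hs] at hinc ⊢
  · have := eq_sub_of_step_le_one (f := ξ) (fun u hu hu' => (abs_le.mp (habs u hu hu')).2)
      (by linarith) ht ht'
    linarith
  · have := eq_sub_of_step_le_one (f := fun u => -ξ u)
      (fun u hu hu' => by linarith [(abs_le.mp (habs u hu hu')).1]) (by linarith) ht ht'
    linarith

/-- To prove a property of all `t` in `[1, p r]`, it suffices to propagate it from right to left
along the segments `[p m, p (m + 1)]`. -/
theorem segment_induction (hr : 1 ≤ r) (hp1 : p 1 = 1) {P : ℕ → Prop} (hlast : P (p r))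
    (hseg : ∀ m, 1 ≤ m → m + 1 ≤ r → P (p (m + 1)) → ∀ t, p m ≤ t → t ≤ p (m + 1) → P t)
    (hmono : StrictMono p) {t : ℕ} (ht : 1 ≤ t) (htr : t ≤ p r) : P t := by
  have key : ∀ k, k + 1 ≤ r → ∀ t, p (r - k) ≤ t → t ≤ p r → P t := by
    intro k
    induction k with
    | zero =>
      intro _ t h₁ h₂
      rwa [le_antisymm h₂ h₁]
    | succ k ih =>
      intro hk t h₁ h₂
      have hrk : r - (k + 1) + 1 = r - k := by omega
      by_cases h : p (r - k) ≤ t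
      · exact ih (by omega) t h h₂
      · refine hseg (r - (k + 1)) (by omega) (by omega) ?_ t h₁ (by rw [hrk]; omega)
        rw [hrk]
        exact ih (by omega) _ le_rfl (hmono.monotone (Nat.sub_le _ _))
  refine key (r - 1) (by omega) t ?_ htr
  rw [Nat.sub_sub_self hr]
  omega

theorem HeightCond.unique (hr : 1 ≤ r) (hmono : StrictMono p) (hp1 : p 1 = 1)
    (hε : ∀ s, 1 ≤ s → s ≤ r → ε s ≤ 1) {ξ ξ' : ℕ → ℤ} (hξ : HeightCond r (p r) p ε ξ)
    (hξ' : HeightCond r (p r) p ε ξ') {t : ℕ} (ht : 1 ≤ t) (htr : t ≤ p r) : ξ' t = ξ t := by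
  refine segment_induction (P := fun t => ξ' t = ξ t) hr hp1 (hξ'.2.1.trans hξ.2.1.symm) ?_
    hmono ht htr
  intro m hm hmr h t h₁ h₂
  rw [hξ.eq_on_segment hmono hp1 hε hm hmr h₁ h₂, hξ'.eq_on_segment hmono hp1 hε hm hmr h₁ h₂, h]

theorem HeightCond.two_dvd_sub (hr : 1 ≤ r) (hmono : StrictMono p) (hp1 : p 1 = 1)
    (hε : ∀ s, 1 ≤ s → s ≤ r → ε s ≤ 1) {ξ : ℕ → ℤ} (hξ : HeightCond r (p r) p ε ξ)
    {t : ℕ} (ht : 1 ≤ t) (htr : t ≤ p r) : (2 : ℤ) ∣ ξ t - t := by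
  refine segment_induction (P := fun t => (2 : ℤ) ∣ ξ t - t) hr hp1 (by simp [hξ.2.1]) ?_
    hmono ht htr
  intro m hm hmr h t h₁ h₂
  have := hξ.eq_on_segment hmono hp1 hε hm hmr h₁ h₂
  rcases heightSlope_cases r ε m with hs | hs <;> rw [hs] at this <;> omega

theorem exists_heightCond (hmono : StrictMono p) (hp1 : p 1 = 1)
    (hε : ∀ s, 1 ≤ s → s ≤ r → ε s ≤ 1)
    (halt : ∀ s, 1 ≤ s → s + 1 ≤ r → ε s + ε (s + 1) = 1) :
    ∃ ξ : ℕ → ℤ, HeightCond r (p r) p ε ξ := by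
  let e : ℕ → ℤ := fun t => heightSlope r ε (Nat.findGreatest (fun m => p m ≤ t) r)
  have he : ∀ m, 1 ≤ m → m + 1 ≤ r → ∀ t, p m ≤ t → t < p (m + 1) → e t = heightSlope r ε m := by
    intro m hm hmr t h₁ h₂
    refine congrArg (heightSlope r ε) (Nat.findGreatest_eq_iff.mpr
      ⟨by omega, fun _ => h₁, fun k hk _ hkt => ?_⟩)
    have := hmono.monotone (Nat.succ_le_of_lt hk)
    simp only [Nat.succ_eq_add_one] at this
    omega
  let S : ℕ → ℤ := fun t => ∑ k ∈ Finset.range t, e k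
  have hS : ∀ t, S (t + 1) = S t + e t := fun t => Finset.sum_range_succ e t
  refine ⟨fun t => S t + (p r - S (p r)), ?_, by simp, ?_, ?_⟩
  · intro t _ _
    simp only [hS]
    rcases heightSlope_cases r ε (Nat.findGreatest (fun m => p m ≤ t) r) with h | h <;>
      simp [e, h]
  · intro m hm hmr h2 hN
    have hmr' : m < r := hmono.lt_iff_lt.mp (by omega)
    obtain ⟨k, rfl⟩ : ∃ k, m = k + 2 := by
      have : 1 < m := hmono.lt_iff_lt.mp (by omega)
      exact Nat.exists_eq_add_of_le' this
    have hlt := hmono (Nat.lt_succ_self (k + 1))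
    have hlt' := hmono (Nat.lt_succ_self (k + 2))
    simp only [Nat.succ_eq_add_one, add_assoc, Nat.reduceAdd] at hlt hlt'
    have h₁ := he (k + 1) (by omega) (by omega) (p (k + 2) - 1) (by omega)
      (show _ < p (k + 2) by omega)
    have h₂ := he (k + 2) (by omega) hmr' (p (k + 2)) le_rfl hlt'
    have h₃ := heightSlope_succ halt (m := k + 1) (by omega) (by omega)
    have h₄ := hS (p (k + 2) - 1)
    rw [Nat.sub_add_cancel (by omega)] at h₄
    have h₅ := hS (p (k + 2))
    simp only [add_assoc, Nat.reduceAdd] at h₃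
    simp only
    linarith
  · intro m hm hmr
    rw [slope_condition_iff (ξ := fun t => S t + (p r - S (p r))) (hε _ (by omega) (by omega))]
    rw [← sum_range_sub_of_const (hmono.monotone (Nat.le_succ m)) (he m hm hmr)]
    simp only [S, Nat.succ_eq_add_one]
    ring

end HeightCond

/-- Existence and uniqueness of the height function `ξ_𝐬`, together with the
parity property `ξ(t) ≡ t (mod 2)`. -/
theorem stmt14 (n r : ℕ) (hn : 1 ≤ n) (hr : 3 ≤ r) (i j : ℕ → ℤ) (ε : ℕ → ℕ)
    (hp : IsPrimeSnake n r i j ε) :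
    ∃ ξ : ℕ → ℤ, HeightCond r (Nval r i j) (pSeq r i j) ε ξ ∧
      (∀ ξ' : ℕ → ℤ, HeightCond r (Nval r i j) (pSeq r i j) ε ξ' →
        ∀ t, 1 ≤ t → t ≤ Nval r i j → ξ' t = ξ t) ∧
      (∀ t, 1 ≤ t → t ≤ Nval r i j → (2 : ℤ) ∣ (ξ t - (t : ℤ))) := by
  obtain ⟨⟨⟨-, hε, -, halt, -⟩, -⟩, -⟩ := hp
  have hmono : StrictMono (pSeq r i j) := strictMono_nat_of_lt_succ (pSeq_lt_succ r i j)
  have hp1 : pSeq r i j 1 = 1 := by simp [pSeq]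
  have hr1 : 1 ≤ r := by omega
  rw [← pSeq_self_eq_Nval r hr i j]
  obtain ⟨ξ, hξ⟩ := exists_heightCond hmono hp1 hε fun s hs hsr => (halt s hs hsr).1
  exact ⟨ξ, hξ, fun ξ' hξ' t ht htr => hξ.unique hr1 hmono hp1 hε hξ' ht htr,
    fun t ht htr => hξ.two_dvd_sub hr1 hmono hp1 hε ht htr⟩
end
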